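/- Let X be a nonempty compact Hausdorff totally disconnected topological space (a Stone space), and let G be a countable group acting on X by homeomorphisms such that for every nonempty clopen subset U ⊆ X and every point x ∈ U, the orbit of x under the rigid stabilizer G_(U) = {h ∈ G | ∀ y ∉ U, h • y = y} is infinite. Fix x ∈ X and let H = Stab_G(x). Then the quasi-regular unitary representation of G on the Hilbert space ℓ²(G/H), where g ∈ G acts by the linear isometry (g · f)(c) = f(g⁻¹ • c) induced by left translation on the coset space G/H, is irreducible: every closed subspace of ℓ²(G/H) invariant under all these operators is either {0} or the whole space. -/

import Mathlib

open Pointwise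

/-- The rigid stabilizer of a subset `U ⊆ X` under an action of `G` on `X`: the subgroup of
elements acting trivially outside of `U`. -/
def rigidStabilizer (G : Type*) {X : Type*} [Group G] [MulAction G X] (U : Set X) :
    Subgroup G where
  carrier := {h : G | ∀ y ∉ U, h • y = y}
  one_mem' := fun y _ => one_smul G y
  mul_mem' := by
    intro a b ha hb y hy
    rw [mul_smul, hb y hy, ha y hy]
  inv_mem' := by
    intro a ha y hy
    conv_lhs => rw [← ha y hy]
    exact inv_smul_smul a y

theorem Memℓp.comp_equiv {ι κ : Type*} {f : ι → ℂ} (hf : Memℓp f 2) (e : κ ≃ ι) :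
    Memℓp (fun k => f (e k)) 2 := by
  apply memℓp_gen
  have h2 : (0:ℝ) < (2 : ENNReal).toReal := by norm_num
  have hs := (memℓp_gen_iff h2).mp hf
  exact (Equiv.summable_iff e (f := fun i => ‖f i‖ ^ (2 : ENNReal).toReal)).mpr hs

/-- The linear isometry equivalence of `ℓ²` spaces induced by a bijection of index sets. -/
noncomputable def lpCongr {ι κ : Type*} (e : ι ≃ κ) :
    lp (fun _ : ι => ℂ) 2 ≃ₗᵢ[ℂ] lp (fun _ : κ => ℂ) 2 where
  toFun f := ⟨fun k => f (e.symm k), (lp.memℓp f).comp_equiv e.symm⟩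
  invFun f := ⟨fun i => f (e i), (lp.memℓp f).comp_equiv e⟩
  left_inv f := lp.ext (funext fun i => by simp)
  right_inv f := lp.ext (funext fun k => by simp)
  map_add' f g := lp.ext (funext fun k => rfl)
  map_smul' c f := lp.ext (funext fun k => rfl)
  norm_map' f := by
    have h2 : (0:ℝ) < (2 : ENNReal).toReal := by norm_num
    rw [lp.norm_eq_tsum_rpow h2, lp.norm_eq_tsum_rpow h2]
    congr 1
    exact e.symm.tsum_eq fun i => ‖f i‖ ^ (2 : ENNReal).toReal

/-- The quasi-regular unitary representation of `G` on `ℓ²(G/H)`: the element `g : G` acts by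
the linear isometry `(g • f) (c) = f (g⁻¹ • c)` induced by left translation on `G ⧸ H`. -/
noncomputable def quasiRegular {G : Type*} [Group G] (H : Subgroup G) (g : G) :
    lp (fun _ : G ⧸ H => ℂ) 2 ≃ₗᵢ[ℂ] lp (fun _ : G ⧸ H => ℂ) 2 :=
  lpCongr (MulAction.toPerm g : Equiv.Perm (G ⧸ H))

theorem quasiRegular_apply {G : Type*} [Group G] (H : Subgroup G) (g : G)
    (f : lp (fun _ : G ⧸ H => ℂ) 2) (c : G ⧸ H) : quasiRegular H g f c = f (g⁻¹ • c) :=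
  rfl

theorem quasiRegular_inv_apply_self {G : Type*} [Group G] (H : Subgroup G) (g : G)
    (f : lp (fun _ : G ⧸ H => ℂ) 2) : quasiRegular H g⁻¹ (quasiRegular H g f) = f :=
  lp.ext <| funext fun c => by simp [quasiRegular_apply]

theorem inner_quasiRegular_right {G : Type*} [Group G] (H : Subgroup G) (g : G)
    (f k : lp (fun _ : G ⧸ H => ℂ) 2) :
    inner ℂ f (quasiRegular H g k) = inner ℂ (quasiRegular H g⁻¹ f) k := by
  rw [← (quasiRegular H g⁻¹).inner_map_map, quasiRegular_inv_apply_self]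

/-- The orthogonal complement of an invariant subspace is invariant. -/
theorem quasiRegular_mem_orthogonal {G : Type*} [Group G] {H : Subgroup G}
    {S : Submodule ℂ (lp (fun _ : G ⧸ H => ℂ) 2)}
    (hS : ∀ g : G, ∀ f ∈ S, quasiRegular H g f ∈ S) (g : G) {f : lp (fun _ : G ⧸ H => ℂ) 2}
    (hf : f ∈ Sᗮ) : quasiRegular H g f ∈ Sᗮ := by
  rw [Submodule.mem_orthogonal] at hf ⊢
  intro u hu
  rw [inner_quasiRegular_right]
  exact hf _ (hS _ u hu)

/-- An invariant subspace all of whose elements vanish at the base point is trivial. -/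
theorem eq_bot_of_quasiRegular_mem {G : Type*} [Group G] {H : Subgroup G}
    {S : Submodule ℂ (lp (fun _ : G ⧸ H => ℂ) 2)}
    (hS : ∀ g : G, ∀ f ∈ S, quasiRegular H g f ∈ S)
    (h_zero : ∀ f ∈ S, f ((1 : G) : G ⧸ H) = 0) : S = ⊥ := by
  rw [Submodule.eq_bot_iff]
  refine fun f hf => lp.ext <| funext fun c => ?_
  induction c using QuotientGroup.induction_on with
  | H g => simpa [quasiRegular_apply] using h_zero _ (hS g⁻¹ f hf)

/-- An `ℓ²` function which is constant on an infinite set vanishes on it. -/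
theorem lp_apply_eq_zero_of_infinite {ι : Type*} (f : lp (fun _ : ι => ℂ) 2) {s : Set ι}
    (hs : s.Infinite) {i : ι} (hf : ∀ j ∈ s, f j = f i) : f i = 0 := by
  by_contra h
  have h2 : (0 : ℝ) < (2 : ENNReal).toReal := by norm_num
  have hsum := (memℓp_gen_iff h2).mp (lp.memℓp f)
  have hpos : 0 < ‖f i‖ ^ (2 : ENNReal).toReal := Real.rpow_pos_of_pos (norm_pos_iff.mpr h) _
  have hev := hsum.tendsto_cofinite_zero.eventually_lt_const hpos
  rw [Filter.eventually_cofinite] at hev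
  refine hs (hev.subset fun j hj => ?_)
  simp [hf j hj]

/-- If every nontrivial `H`-orbit on `G ⧸ H` is infinite, then the quasi-regular representation
of `G` on `ℓ²(G ⧸ H)` is irreducible. -/
theorem quasiRegular_irreducible_of_infinite_orbits {G : Type*} [Group G] {H : Subgroup G}
    (h_orb : ∀ c : G ⧸ H, c ≠ ((1 : G) : G ⧸ H) → (MulAction.orbit H c).Infinite)
    {S : Submodule ℂ (lp (fun _ : G ⧸ H => ℂ) 2)}
    (hS_closed : IsClosed (S : Set (lp (fun _ : G ⧸ H => ℂ) 2)))
    (hS : ∀ g : G, ∀ f ∈ S, quasiRegular H g f ∈ S) : S = ⊥ ∨ S = ⊤ := by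
  classical
  have : CompleteSpace S := hS_closed.completeSpace_coe
  set δ : lp (fun _ : G ⧸ H => ℂ) 2 := lp.single 2 ((1 : G) : G ⧸ H) 1 with hδ
  have inner_δ (f : lp (fun _ : G ⧸ H => ℂ) 2) : inner ℂ δ f = f ((1 : G) : G ⧸ H) := by
    simp [hδ, lp.inner_single_left]
  obtain ⟨v, hv, w, hw, hvw⟩ := S.exists_add_mem_mem_orthogonal δ
  have δ_fixed (h : H) : quasiRegular H (h : G) δ = δ := by
    refine lp.ext <| funext fun c => ?_
    have : (h : G)⁻¹ • c = ((1 : G) : G ⧸ H) ↔ c = ((1 : G) : G ⧸ H) := by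
      rw [inv_smul_eq_iff, MulAction.Quotient.smul_coe, smul_eq_mul, mul_one,
        (QuotientGroup.eq (a := (h : G)) (b := 1)).mpr (by simp)]
    simp [quasiRegular_apply, hδ, Pi.single_apply, this]
  have v_fixed (h : H) : quasiRegular H (h : G) v = v := by
    have hsub : quasiRegular H (h : G) v - v = w - quasiRegular H (h : G) w := by
      rw [sub_eq_sub_iff_add_eq_add, ← map_add, ← hvw, δ_fixed, hvw, add_comm]
    rw [← sub_eq_zero]
    refine S.orthogonal_disjoint.le_bot ⟨S.sub_mem (hS _ v hv) hv, ?_⟩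
    rw [hsub]
    exact Sᗮ.sub_mem hw (quasiRegular_mem_orthogonal hS _ hw)
  have v_zero (c : G ⧸ H) (hc : c ≠ ((1 : G) : G ⧸ H)) : v c = 0 := by
    refine lp_apply_eq_zero_of_infinite v (h_orb c hc) ?_
    rintro _ ⟨h, rfl⟩
    conv_lhs => rw [← v_fixed h, quasiRegular_apply]
    exact congrArg v (inv_smul_smul (h : G) c)
  have v_eq : v = v ((1 : G) : G ⧸ H) • δ := by
    refine lp.ext <| funext fun c => ?_
    by_cases hc : c = ((1 : G) : G ⧸ H)
    · simp [hc, hδ]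
    · simp [v_zero c hc, hδ, hc]
  by_cases h0 : v ((1 : G) : G ⧸ H) = 0
  · left
    have hδ_mem : δ ∈ Sᗮ := by
      rw [h0, zero_smul] at v_eq
      rwa [hvw, v_eq, zero_add]
    refine eq_bot_of_quasiRegular_mem hS fun f hf => ?_
    rw [← inner_δ]
    exact Submodule.inner_left_of_mem_orthogonal hf hδ_mem
  · right
    have hδ_mem : δ ∈ S := by
      rw [v_eq] at hv
      exact (S.smul_mem_iff h0).mp hv
    rw [← Submodule.orthogonal_eq_bot_iff]
    refine eq_bot_of_quasiRegular_mem (fun g f => quasiRegular_mem_orthogonal hS g) fun f hf => ?_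
    rw [← inner_δ]
    exact Submodule.inner_right_of_mem_orthogonal hδ_mem hf

theorem rigidStabilizer_le_stabilizer {G X : Type*} [Group G] [MulAction G X] {U : Set X} {x : X}
    (hx : x ∉ U) : rigidStabilizer G U ≤ MulAction.stabilizer G x :=
  fun _ hg => hg x hx

/-- Let `X` be a Stone space and `G` a countable group acting on `X` by
homeomorphisms with infinite rigid-stabilizer orbits on nonempty clopen sets. Then for every
`x ∈ X`, the quasi-regular representation of `G` on `ℓ²(G / Stab_G(x))` is irreducible: every
closed invariant subspace is `⊥` or `⊤`. -/
theorem quasiRegular_stabilizer_irreducible {G X : Type*} [Group G] [Countable G]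
    [TopologicalSpace X] [CompactSpace X] [T2Space X] [TotallyDisconnectedSpace X]
    [Nonempty X] [MulAction G X] (hcont : ∀ g : G, Continuous fun x : X => g • x)
    (horb : ∀ U : Set X, IsClopen U → U.Nonempty → ∀ x ∈ U,
      (MulAction.orbit (↥(rigidStabilizer G U)) x).Infinite)
    (x : X) :
    ∀ S : Submodule ℂ (lp (fun _ : G ⧸ MulAction.stabilizer G x => ℂ) 2),
      IsClosed (S : Set (lp (fun _ : G ⧸ MulAction.stabilizer G x => ℂ) 2)) →
      (∀ g : G, ∀ f ∈ S, quasiRegular (MulAction.stabilizer G x) g f ∈ S) →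
      S = ⊥ ∨ S = ⊤ := by
  intro S hS_closed hS
  refine quasiRegular_irreducible_of_infinite_orbits (fun c hc => ?_) hS_closed hS
  induction c using QuotientGroup.induction_on with
  | H g =>
    have hgx : g • x ≠ x := fun h => hc <| by
      rw [QuotientGroup.eq]
      simpa [MulAction.mem_stabilizer_iff, inv_smul_eq_iff, eq_comm] using h
    obtain ⟨U, hU, hgU, hUx⟩ := compact_exists_isClopen_in_isOpen
      (isOpen_compl_singleton (x := x)) (show g • x ∈ ({x} : Set X)ᶜ from hgx)
    have hxU : x ∉ U := fun h => hUx h rfl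
    refine Set.Infinite.of_image (MulAction.ofQuotientStabilizer G x)
      ((horb U hU ⟨_, hgU⟩ _ hgU).mono ?_)
    rintro _ ⟨h, rfl⟩
    refine ⟨_, ⟨⟨(h : G), rigidStabilizer_le_stabilizer hxU h.2⟩, rfl⟩, ?_⟩
    exact mul_smul (h : G) g x
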